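/- (Krylov–Safonov Harnack inequality) There exists a constant C > 0 depending only on n, λ, Λ such that: if a_{ij} : B₁ → ℝ are uniformly elliptic (merely measurable and bounded) coefficients and v ∈ C²(B₁) is nonnegative and satisfies Σ_{i,j} a_{ij}(x) ∂_{ij} v(x) = 0 for every x ∈ B₁, then sup_{B_{1/2}} v ≤ C inf_{B_{1/2}} v. -/

import Mathlib

open MeasureTheory Metric Set Filter
open scoped ENNReal NNReal Topology

noncomputable section

/-- Euclidean space `ℝⁿ`. -/
abbrev En (n : ℕ) := EuclideanSpace ℝ (Fin n)

/-- The second partial derivative `∂_{ij} v (x)`. -/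
def pd2 {n : ℕ} (v : En n → ℝ) (i j : Fin n) (x : En n) : ℝ :=
  fderiv ℝ (fun y => fderiv ℝ v y (EuclideanSpace.single i 1)) x (EuclideanSpace.single j 1)

/-- Measurable, uniformly elliptic coefficients on `Ω`:
`λ|ξ|² ≤ Σ aᵢⱼ(x) ξᵢ ξⱼ ≤ Λ|ξ|²` for every `x ∈ Ω` and all `ξ`. -/
def UnifEllipticOn {n : ℕ} (Ω : Set (En n)) (lam Lam : ℝ)
    (a : Fin n → Fin n → En n → ℝ) : Prop :=
  (∀ i j, Measurable (a i j)) ∧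
    ∀ x ∈ Ω, ∀ ξ : En n,
      lam * ∑ i, ξ i ^ 2 ≤ ∑ i, ∑ j, a i j x * ξ i * ξ j ∧
      ∑ i, ∑ j, a i j x * ξ i * ξ j ≤ Lam * ∑ i, ξ i ^ 2


/-- Pointwise ellipticity of a coefficient matrix. -/
def Ell {n : ℕ} (lam Lam : ℝ) (A : Fin n → Fin n → ℝ) : Prop :=
  ∀ ξ : En n, lam * ∑ i, ξ i ^ 2 ≤ ∑ i, ∑ j, A i j * ξ i * ξ j ∧
      ∑ i, ∑ j, A i j * ξ i * ξ j ≤ Lam * ∑ i, ξ i ^ 2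

/-- Solutions of some uniformly elliptic equation in a ball. -/
def Sol {n : ℕ} (lam Lam : ℝ) (x₀ : En n) (r : ℝ) (u : En n → ℝ) : Prop :=
  ContDiffOn ℝ 2 u (ball x₀ r) ∧ ∀ x ∈ ball x₀ r, ∃ A : Fin n → Fin n → ℝ,
    Ell lam Lam A ∧ ∑ i, ∑ j, A i j * pd2 u i j x = 0

open scoped MatrixOrder in
lemma psd_decomp {n : ℕ} (H : Fin n → Fin n → ℝ) (hs : ∀ i j, H i j = H j i)
    (hp : ∀ ξ : En n, 0 ≤ ∑ i, ∑ j, H i j * ξ i * ξ j) :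
    ∃ B : Fin n → Fin n → ℝ, ∀ i j, H i j = ∑ k, B k i * B k j := by
  have h : (Matrix.of H).PosSemidef := by
    refine Matrix.PosSemidef.of_dotProduct_mulVec_nonneg ?_ ?_
    · ext i j
      simp [Matrix.conjTranspose, hs i j]
    · intro x
      have := hp (WithLp.toLp 2 x)
      simp only [dotProduct, Matrix.mulVec, Finset.mul_sum, Matrix.of_apply]
      refine this.trans_eq (Finset.sum_congr rfl fun i _ => Finset.sum_congr rfl fun j _ => ?_)
      simp only [Pi.star_apply, star_trivial]
      ring
  obtain ⟨B, hB⟩ := CStarAlgebra.nonneg_iff_eq_star_mul_self.mp h.nonneg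
  refine ⟨B, fun i j => ?_⟩
  have : Matrix.of H i j = (star B * B) i j := by rw [hB]
  simpa [Matrix.mul_apply, Matrix.star_apply] using this

lemma ell_trace {n : ℕ} {lam Lam : ℝ} {A : Fin n → Fin n → ℝ} (hA : Ell lam Lam A)
    (H : Fin n → Fin n → ℝ) (hs : ∀ i j, H i j = H j i)
    (hp : ∀ ξ : En n, 0 ≤ ∑ i, ∑ j, H i j * ξ i * ξ j) :
    lam * ∑ i, H i i ≤ ∑ i, ∑ j, A i j * H i j ∧
      ∑ i, ∑ j, A i j * H i j ≤ Lam * ∑ i, H i i := by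
  obtain ⟨B, hB⟩ := psd_decomp H hs hp
  have e1 : ∑ i, H i i = ∑ k, ∑ i, B k i ^ 2 := by
    rw [Finset.sum_comm]
    exact Finset.sum_congr rfl fun i _ => by rw [hB]; exact Finset.sum_congr rfl fun k _ => by ring
  have e2 : ∑ i, ∑ j, A i j * H i j = ∑ k, ∑ i, ∑ j, A i j * B k i * B k j := by
    rw [Finset.sum_comm (γ := Fin n) (f := fun k i => ∑ j, A i j * B k i * B k j)]
    refine Finset.sum_congr rfl fun i _ => ?_
    rw [Finset.sum_comm]
    refine Finset.sum_congr rfl fun j _ => ?_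
    rw [hB, Finset.mul_sum]
    exact Finset.sum_congr rfl fun k _ => by ring
  rw [e1, e2, Finset.mul_sum, Finset.mul_sum]
  exact ⟨Finset.sum_le_sum fun k _ => by simpa using (hA (WithLp.toLp 2 (B k))).1,
    Finset.sum_le_sum fun k _ => by simpa using (hA (WithLp.toLp 2 (B k))).2⟩

lemma psd_entry_le {n : ℕ} (H : Fin n → Fin n → ℝ) (hs : ∀ i j, H i j = H j i)
    (hp : ∀ ξ : En n, 0 ≤ ∑ i, ∑ j, H i j * ξ i * ξ j) (i j : Fin n) :
    |H i j| ≤ ∑ i, H i i := by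
  obtain ⟨B, hB⟩ := psd_decomp H hs hp
  have hd : ∀ i, 0 ≤ H i i := fun i => by
    rw [hB]; exact Finset.sum_nonneg fun k _ => mul_self_nonneg _
  have h1 : ∀ i, H i i ≤ ∑ i, H i i := fun i =>
    Finset.single_le_sum (f := fun i => H i i) (fun i _ => hd i) (Finset.mem_univ i)
  have h2 : |H i j| ≤ (H i i + H j j) / 2 := by
    rw [abs_le]
    rw [hB i j, hB i i, hB j j, ← Finset.sum_add_distrib, Finset.sum_div, ← Finset.sum_neg_distrib]
    constructor
    · exact Finset.sum_le_sum fun k _ => by nlinarith [sq_nonneg (B k i + B k j)]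
    · exact Finset.sum_le_sum fun k _ => by nlinarith [sq_nonneg (B k i - B k j)]
  linarith [h1 i, h1 j]

lemma deriv2_nonneg_of_min {h : ℝ → ℝ} (hmin : IsLocalMin h 0) (hc : ContinuousAt h 0) :
    0 ≤ deriv (deriv h) 0 := by
  by_contra hneg
  push Not at hneg
  have hmax := isLocalMax_of_deriv_deriv_neg hneg hmin.deriv_eq_zero hc
  have heq : h =ᶠ[𝓝 0] fun _ => h 0 := by
    filter_upwards [hmin, hmax] with t h1 h2
    exact le_antisymm h2 h1
  have h2 : deriv h =ᶠ[𝓝 0] deriv (fun _ => h 0) := heq.deriv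
  rw [h2.deriv_eq] at hneg
  simp at hneg

lemma pd2_eq {n : ℕ} {w : En n → ℝ} {x : En n} (hw : ContDiffAt ℝ 2 w x) (i j : Fin n) :
    pd2 w i j x = fderiv ℝ (fderiv ℝ w) x (EuclideanSpace.single j 1)
      (EuclideanSpace.single i 1) := by
  have hd : DifferentiableAt ℝ (fderiv ℝ w) x :=
    (hw.fderiv_right (m := 1) (by norm_num)).differentiableAt (by norm_num)
  unfold pd2
  rw [fderiv_clm_apply hd (differentiableAt_const _)]
  simp

lemma pd2_symm {n : ℕ} {w : En n → ℝ} {x : En n} (hw : ContDiffAt ℝ 2 w x) (i j : Fin n) :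
    pd2 w i j x = pd2 w j i x := by
  rw [pd2_eq hw, pd2_eq hw]
  exact (hw.isSymmSndFDerivAt (by simp)) _ _

lemma pd2_add {n : ℕ} {w v : En n → ℝ} {x : En n} (hw : ContDiffAt ℝ 2 w x)
    (hv : ContDiffAt ℝ 2 v x) (i j : Fin n) :
    pd2 (fun y => w y + v y) i j x = pd2 w i j x + pd2 v i j x := by
  rw [pd2_eq hw, pd2_eq hv, pd2_eq (hw.add hv)]
  have hd : DifferentiableAt ℝ (fderiv ℝ w) x :=
    (hw.fderiv_right (m := 1) (by norm_num)).differentiableAt (by norm_num)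
  have hd' : DifferentiableAt ℝ (fderiv ℝ v) x :=
    (hv.fderiv_right (m := 1) (by norm_num)).differentiableAt (by norm_num)
  have : fderiv ℝ (fun y => w y + v y) =ᶠ[𝓝 x] fun y => fderiv ℝ w y + fderiv ℝ v y := by
    filter_upwards [hw.eventually (by simp), hv.eventually (by simp)] with y h1 h2
    exact fderiv_fun_add (h1.differentiableAt (by norm_num)) (h2.differentiableAt (by norm_num))
  rw [this.fderiv_eq, fderiv_fun_add hd hd']
  simp

lemma pd2_affine {n : ℕ} {w : En n → ℝ} {x : En n} (hw : ContDiffAt ℝ 2 w x)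
    (α β : ℝ) (i j : Fin n) :
    pd2 (fun y => α * w y + β) i j x = α * pd2 w i j x := by
  have hv : ContDiffAt ℝ 2 (fun y => α * w y + β) x := by fun_prop
  rw [pd2_eq hw, pd2_eq hv]
  have hd : DifferentiableAt ℝ (fderiv ℝ w) x :=
    (hw.fderiv_right (m := 1) (by norm_num)).differentiableAt (by norm_num)
  have : fderiv ℝ (fun y => α * w y + β) =ᶠ[𝓝 x] fun y => α • fderiv ℝ w y := by
    filter_upwards [hw.eventually (by simp)] with y h1
    rw [fderiv_add_const, fderiv_const_mul (h1.differentiableAt (by norm_num))]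
  rw [this.fderiv_eq, fderiv_fun_const_smul hd]
  simp

lemma Sol.affine {n : ℕ} {lam Lam : ℝ} {x₀ : En n} {r : ℝ} {u : En n → ℝ}
    (h : Sol lam Lam x₀ r u) (α β : ℝ) : Sol lam Lam x₀ r (fun y => α * u y + β) := by
  refine ⟨?_, fun x hx => ?_⟩
  · exact (contDiffOn_const.mul h.1).add contDiffOn_const
  · obtain ⟨A, hA, hA'⟩ := h.2 x hx
    refine ⟨A, hA, ?_⟩
    have hc : ContDiffAt ℝ 2 u x := h.1.contDiffAt (isOpen_ball.mem_nhds hx)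
    simp_rw [pd2_affine hc]
    have : ∀ i j, A i j * (α * pd2 u i j x) = α * (A i j * pd2 u i j x) := fun i j => by ring
    simp_rw [this, ← Finset.mul_sum, hA', mul_zero]

lemma Sol.mono {n : ℕ} {lam Lam : ℝ} {x₀ x₁ : En n} {r s : ℝ} {u : En n → ℝ}
    (h : Sol lam Lam x₀ r u) (hs : ball x₁ s ⊆ ball x₀ r) : Sol lam Lam x₁ s u :=
  ⟨h.1.mono hs, fun x hx => h.2 x (hs hx)⟩

lemma en_eq_sum {n : ℕ} (ξ : En n) : ξ = ∑ i, ξ i • EuclideanSpace.single i (1 : ℝ) := by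
  ext k
  simp [Finset.sum_apply, Pi.single_apply]

lemma hess_quad {n : ℕ} {w : En n → ℝ} {x : En n} (hw : ContDiffAt ℝ 2 w x) (ξ : En n) :
    fderiv ℝ (fderiv ℝ w) x ξ ξ = ∑ i, ∑ j, pd2 w i j x * ξ i * ξ j := by
  simp_rw [pd2_eq hw]
  conv_lhs => rw [en_eq_sum ξ]
  simp only [map_sum, map_smul, sum_apply, smul_apply,
    smul_eq_mul, Finset.mul_sum]
  refine Finset.sum_congr rfl fun i _ => Finset.sum_congr rfl fun j _ => ?_
  ring

lemma hess_min {n : ℕ} {w : En n → ℝ} {x : En n} (hw : ContDiffAt ℝ 2 w x)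
    (hmin : IsLocalMin w x) (ξ : En n) :
    0 ≤ ∑ i, ∑ j, pd2 w i j x * ξ i * ξ j := by
  rw [← hess_quad hw]
  have hd : DifferentiableAt ℝ (fderiv ℝ w) x :=
    (hw.fderiv_right (m := 1) (by norm_num)).differentiableAt (by norm_num)
  set l : ℝ → En n := fun t => x + t • ξ with hl
  have hl0 : l 0 = x := by simp [hl]
  have hld : ∀ t, HasDerivAt l ξ t := fun t => by
    have h := ((hasDerivAt_id t).smul_const ξ).const_add x
    rw [one_smul] at h
    exact h
  have hlc : Tendsto l (𝓝 0) (𝓝 x) := by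
    have := (hld 0).continuousAt.tendsto
    rwa [hl0] at this
  have h1 : IsLocalMin (fun t => w (l t)) 0 := by
    have := hlc.eventually hmin
    filter_upwards [this] with t ht
    simpa [hl0] using ht
  have hdw : deriv (fun t => w (l t)) =ᶠ[𝓝 0] fun t => fderiv ℝ w (l t) ξ := by
    filter_upwards [hlc.eventually (hw.eventually (by simp))] with t ht
    exact ((ht.differentiableAt (by norm_num)).hasFDerivAt.comp_hasDerivAt t (hld t)).deriv
  have h2 := deriv2_nonneg_of_min h1 (by
    have : ContinuousAt w (l 0) := by rw [hl0]; exact hw.continuousAt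
    exact this.comp (hld 0).continuousAt)
  rw [hdw.deriv_eq] at h2
  have hd' : HasFDerivAt (fderiv ℝ w) (fderiv ℝ (fderiv ℝ w) x) (l 0) := by
    rw [hl0]; exact hd.hasFDerivAt
  have h3 : HasDerivAt (fun t => fderiv ℝ w (l t) ξ) (fderiv ℝ (fderiv ℝ w) x ξ ξ) 0 := by
    have := (hd'.comp_hasDerivAt (0 : ℝ) (hld 0)).clm_apply (hasDerivAt_const (0 : ℝ) ξ)
    simpa using this
  rw [h3.deriv] at h2
  exact h2

lemma radial_hasFDerivAt {n : ℕ} {f : ℝ → ℝ} {f' : ℝ} (y x : En n)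
    (h : HasDerivAt f f' (‖x - y‖ ^ 2)) :
    HasFDerivAt (fun z : En n => f (‖z - y‖ ^ 2)) ((2 * f') • innerSL ℝ (x - y)) x := by
  have h1 : HasFDerivAt (fun z : En n => ‖z - y‖ ^ 2) ((2 : ℝ) • innerSL ℝ (x - y)) x := by
    have h0 := ((hasFDerivAt_id x).sub_const y).norm_sq
    refine h0.congr_fderiv ?_
    ext v
    simp [two_smul]
  refine (h.comp_hasFDerivAt x h1).congr_fderiv ?_
  rw [smul_smul, mul_comm]

lemma pd2_radial {n : ℕ} {f f1 : ℝ → ℝ} {f2 : ℝ} (y x : En n)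
    (h1 : ∀ t, 0 ≤ t → HasDerivAt f (f1 t) t) (h2 : HasDerivAt f1 f2 (‖x - y‖ ^ 2)) (i j : Fin n) :
    pd2 (fun z : En n => f (‖z - y‖ ^ 2)) i j x =
      4 * f2 * (x - y) i * (x - y) j + 2 * f1 (‖x - y‖ ^ 2) * (if i = j then 1 else 0) := by
  unfold pd2
  have e : (fun z : En n => fderiv ℝ (fun z : En n => f (‖z - y‖ ^ 2)) z (EuclideanSpace.single i 1))
      = fun z => (2 * f1 (‖z - y‖ ^ 2)) * (z i - y i) := by
    ext z
    rw [(radial_hasFDerivAt y z (h1 _ (by positivity))).fderiv]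
    simp [inner_sub_left, EuclideanSpace.inner_single_right]
  rw [e]
  have h3 := (radial_hasFDerivAt y x h2).const_mul 2
  have h4 : HasFDerivAt (fun z : En n => z i - y i) (EuclideanSpace.proj i : En n →L[ℝ] ℝ) x :=
    (EuclideanSpace.proj i : En n →L[ℝ] ℝ).hasFDerivAt.sub_const _
  rw [(h3.fun_mul h4).fderiv]
  simp [inner_sub_left, EuclideanSpace.inner_single_right, Pi.single_apply]
  split_ifs <;> ring

/-- The linear map turning a linear form into its gradient. -/
def gradL (n : ℕ) : (En n →L[ℝ] ℝ) →L[ℝ] En n :=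
  ∑ i, (ContinuousLinearMap.apply ℝ ℝ (EuclideanSpace.single i (1 : ℝ) : En n)).smulRight
    (EuclideanSpace.single i (1 : ℝ))

lemma gradL_apply {n : ℕ} (φ : En n →L[ℝ] ℝ) (i : Fin n) :
    gradL n φ i = φ (EuclideanSpace.single i 1) := by
  simp [gradL, sum_apply, Finset.sum_apply, Pi.single_apply]

lemma det_bound {n : ℕ} (M : En n →L[ℝ] En n) (c : ℝ)
    (h : ∀ i j, |M (EuclideanSpace.single j 1) i| ≤ c) :
    |M.det| ≤ (n.factorial : ℝ) * c ^ n := by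
  have e : M.det = (LinearMap.toMatrix (EuclideanSpace.basisFun (Fin n) ℝ).toBasis
      (EuclideanSpace.basisFun (Fin n) ℝ).toBasis (M : En n →ₗ[ℝ] En n)).det := by
    rw [LinearMap.det_toMatrix]
  rw [e]
  have := Matrix.det_le (abv := AbsoluteValue.abs) (x := c)
    (A := LinearMap.toMatrix (EuclideanSpace.basisFun (Fin n) ℝ).toBasis
      (EuclideanSpace.basisFun (Fin n) ℝ).toBasis (M : En n →ₗ[ℝ] En n)) (by
      intro i j
      rw [LinearMap.toMatrix_apply]
      simpa using h i j)
  simpa using this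

lemma contact_measure {n : ℕ} (hn : 2 ≤ n) {lam Lam : ℝ} (hlam : 0 < lam) (hLam : lam ≤ Lam) :
    ∃ θ : ℝ, 0 < θ ∧ ∀ (x₀ : En n) (r : ℝ) (u : En n → ℝ), 0 < r → Sol lam Lam x₀ r u →
      (∀ x ∈ ball x₀ r, 0 ≤ u x) → ∀ x₁ ∈ ball x₀ (r / 2), u x₁ < 8 / 9 →
      ENNReal.ofReal θ * volume (ball x₀ r) ≤ volume {x | x ∈ ball x₀ r ∧ u x < 1} := by
  set K : ℝ := (n.factorial : ℝ) * (n * Lam / lam) ^ n + 1 with hK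
  have hLp : 0 < Lam := hlam.trans_le hLam
  have hKp : 0 < K := by positivity
  have : Nontrivial (En n) := by
    have : Nonempty (Fin n) := ⟨⟨0, by omega⟩⟩
    infer_instance
  refine ⟨K⁻¹ * (1 / 8) ^ n, by positivity, ?_⟩
  intro x₀ r u hr hu hpos x₁ hx₁ hux₁
  set k : ℝ := 128 / (9 * r ^ 2) with hk
  have hkp : 0 < k := by positivity
  have hkr : k * r ^ 2 = 128 / 9 := by rw [hk]; field_simp
  set DT : En n → (En n →L[ℝ] En n) := fun x =>
    ContinuousLinearMap.id ℝ (En n) + k⁻¹ • (gradL n).comp (fderiv ℝ (fderiv ℝ u) x) with hDT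
  set T : En n → En n := fun x => x + k⁻¹ • gradL n (fderiv ℝ u x) with hT
  have hfd : ContDiffOn ℝ 1 (fderiv ℝ u) (ball x₀ r) :=
    hu.1.fderiv_of_isOpen isOpen_ball (by norm_num)
  have hfd2 : ContinuousOn (fderiv ℝ (fderiv ℝ u)) (ball x₀ r) :=
    hfd.continuousOn_fderiv_of_isOpen isOpen_ball (by norm_num)
  have hDTc : ContinuousOn (fun x => |(DT x).det|) (ball x₀ r) := by
    have h1 : ContinuousOn DT (ball x₀ r) := by
      refine continuousOn_const.add (ContinuousOn.fun_const_smul ?_ _)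
      exact continuousOn_const.clm_comp hfd2
    exact (ContinuousLinearMap.continuous_det.comp_continuousOn h1).abs
  set S : Set (En n) := (ball x₀ r ∩ u ⁻¹' (Iio 1)) ∩
    (ball x₀ r ∩ (fun x => |(DT x).det|) ⁻¹' (Iio K)) with hS
  have hSo : IsOpen S := (hu.1.continuousOn.isOpen_inter_preimage isOpen_ball isOpen_Iio).inter
    (hDTc.isOpen_inter_preimage isOpen_ball isOpen_Iio)
  have hder : ∀ x ∈ S, HasFDerivWithinAt T (DT x) S x := by
    intro x hx
    have h1 : DifferentiableAt ℝ (fderiv ℝ u) x :=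
      (hfd.contDiffAt (isOpen_ball.mem_nhds hx.1.1)).differentiableAt (by norm_num)
    have h2 : HasFDerivAt T (DT x) x :=
      (hasFDerivAt_id x).add
        (((gradL n).hasFDerivAt.comp x h1.hasFDerivAt).const_smul k⁻¹)
    exact h2.hasFDerivWithinAt
  have hx₁' : dist x₁ x₀ < r / 2 := hx₁
  have hsub : closedBall x₁ (r / 2) ⊆ ball x₀ r := by
    intro z hz
    have : dist z x₁ ≤ r / 2 := hz
    have := dist_triangle z x₁ x₀
    show dist z x₀ < r
    linarith
  have hcover : ball x₁ (r / 8) ⊆ T '' S := by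
    intro y hy
    have hy' : dist x₁ y < r / 8 := by rw [dist_comm]; exact hy
    have hqc : Continuous (fun z : En n => k / 2 * ‖z - y‖ ^ 2) := by fun_prop
    obtain ⟨x, hxm, hxmin⟩ := (isCompact_closedBall x₁ (r / 2)).exists_isMinOn
      ⟨x₁, mem_closedBall_self (by positivity)⟩
      ((hu.1.continuousOn.mono hsub).add hqc.continuousOn)
    have hval : u x + k / 2 * ‖x - y‖ ^ 2 ≤ u x₁ + k / 2 * ‖x₁ - y‖ ^ 2 :=
      hxmin (mem_closedBall_self (by positivity))
    have hx₁y : ‖x₁ - y‖ ^ 2 ≤ (r / 8) ^ 2 := by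
      rw [← dist_eq_norm]; gcongr
    have hval2 : u x + k / 2 * ‖x - y‖ ^ 2 < 8 / 9 + 1 / 9 := by
      have : k / 2 * ‖x₁ - y‖ ^ 2 ≤ k / 2 * (r / 8) ^ 2 := by gcongr
      nlinarith
    have hxB : x ∈ ball x₀ r := hsub hxm
    have hux0 := hpos x hxB
    have hux1 : u x < 1 := by
      have : 0 ≤ k / 2 * ‖x - y‖ ^ 2 := by positivity
      linarith
    have hxint : x ∈ ball x₁ (r / 2) := by
      by_contra hcon
      have h1 : r / 2 ≤ dist x x₁ := by simpa using hcon
      have h2 := dist_triangle x y x₁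
      have h3 : 3 * r / 8 ≤ ‖x - y‖ := by
        rw [← dist_eq_norm]; rw [dist_comm y x₁] at h2; linarith
      have h4 : (3 * r / 8) ^ 2 ≤ ‖x - y‖ ^ 2 := by gcongr
      have h5 : k / 2 * (3 * r / 8) ^ 2 ≤ k / 2 * ‖x - y‖ ^ 2 := by gcongr
      nlinarith
    have hloc : IsLocalMin (fun z => u z + k / 2 * ‖z - y‖ ^ 2) x := by
      have : IsMinOn (fun z => u z + k / 2 * ‖z - y‖ ^ 2) (closedBall x₁ (r / 2)) x := hxmin
      exact this.isLocalMin (mem_of_superset (isOpen_ball.mem_nhds hxint) ball_subset_closedBall)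
    have huc : ContDiffAt ℝ 2 u x := hu.1.contDiffAt (isOpen_ball.mem_nhds hxB)
    have hqd : ContDiffAt ℝ 2 (fun z : En n => k / 2 * ‖z - y‖ ^ 2) x := by
      have : ContDiff ℝ 2 (fun z : En n => k / 2 * ‖z - y‖ ^ 2) :=
        contDiff_const.mul ((contDiff_id.sub contDiff_const).norm_sq ℝ)
      exact this.contDiffAt
    have hqD : ∀ t : ℝ, HasDerivAt (fun t : ℝ => k / 2 * t) (k / 2) t := fun t => by
      simpa using (hasDerivAt_id t).const_mul (k / 2)
    -- first order
    have hfirst : fderiv ℝ u x = - (k • innerSL ℝ (x - y)) := by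
      have h1 := hloc.fderiv_eq_zero
      have h2 := radial_hasFDerivAt (f := fun t => k / 2 * t) y x (hqD _)
      have h3 := ((huc.differentiableAt (by norm_num)).hasFDerivAt.add h2).fderiv
      have h4 : fderiv ℝ u x + (2 * (k / 2)) • innerSL ℝ (x - y) = 0 := h3.symm.trans h1
      rw [eq_neg_of_add_eq_zero_left h4]
      congr 2
      ring
    -- second order
    set H : Fin n → Fin n → ℝ := fun i j => pd2 (fun z => u z + k / 2 * ‖z - y‖ ^ 2) i j x with hH
    have hHe : ∀ i j, H i j = pd2 u i j x + k * (if i = j then 1 else 0) := by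
      intro i j
      rw [hH]
      simp only
      rw [pd2_add huc hqd, pd2_radial (f := fun t => k / 2 * t) (f1 := fun _ => k / 2) y x
        (fun t _ => hqD t) (hasDerivAt_const _ _)]
      ring
    have hHs : ∀ i j, H i j = H j i := fun i j => pd2_symm (huc.add hqd) i j
    have hHp : ∀ ξ : En n, 0 ≤ ∑ i, ∑ j, H i j * ξ i * ξ j := hess_min (huc.add hqd) hloc
    obtain ⟨A, hA, hA0⟩ := hu.2 x hxB
    have htr := (ell_trace hA H hHs hHp).1
    have hAtr : ∑ i, A i i ≤ n * Lam := by
      have : ∀ i, A i i ≤ Lam := fun i => by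
        have := (hA (EuclideanSpace.single i 1)).2
        simpa [Pi.single_apply] using this
      calc ∑ i, A i i ≤ ∑ _i : Fin n, Lam := Finset.sum_le_sum fun i _ => this i
        _ = n * Lam := by simp
    have hAH : ∑ i, ∑ j, A i j * H i j = k * ∑ i, A i i := by
      simp_rw [hHe, mul_add, Finset.sum_add_distrib, hA0, zero_add]
      simp [Finset.mul_sum, mul_comm]
    have htr2 : ∑ i, H i i ≤ k * (n * Lam / lam) := by
      rw [hAH] at htr
      have : lam * ∑ i, H i i ≤ k * (n * Lam) := htr.trans (by gcongr)
      rw [← mul_div_assoc, le_div_iff₀ hlam]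
      linarith
    have hdet : |(DT x).det| ≤ (n.factorial : ℝ) * (n * Lam / lam) ^ n := by
      refine det_bound _ _ fun i j => ?_
      have e : DT x (EuclideanSpace.single j 1) i = k⁻¹ * H i j := by
        rw [hHe, pd2_eq huc]
        simp [hDT, gradL_apply, Pi.single_apply]
        field_simp
        split_ifs <;> ring
      rw [e, abs_mul, abs_of_pos (inv_pos.2 hkp), inv_mul_le_iff₀ hkp]
      exact (psd_entry_le H hHs hHp i j).trans htr2
    refine ⟨x, ⟨⟨hxB, hux1⟩, hxB, ?_⟩, ?_⟩
    · show |(DT x).det| < K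
      linarith
    · ext i
      simp [hT, gradL_apply, hfirst, inner_sub_left, EuclideanSpace.inner_single_right]
      field_simp
      ring
  have hm1 : volume (ball x₁ (r / 8)) ≤ ENNReal.ofReal K * volume S := by
    calc volume (ball x₁ (r / 8)) ≤ volume (T '' S) := measure_mono hcover
      _ ≤ ∫⁻ x in S, ENNReal.ofReal |(DT x).det| :=
        addHaar_image_le_lintegral_abs_det_fderiv volume hSo.measurableSet hder
      _ ≤ ∫⁻ _x in S, ENNReal.ofReal K := by
        refine setLIntegral_mono' hSo.measurableSet fun x hx => ?_
        exact ENNReal.ofReal_le_ofReal (le_of_lt hx.2.2)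
      _ = ENNReal.ofReal K * volume S := by simp
  have hm2 : volume (ball x₁ (r / 8)) = ENNReal.ofReal ((1 / 8) ^ n) * volume (ball x₀ r) := by
    rw [Measure.addHaar_ball _ _ (by positivity), Measure.addHaar_ball _ x₀ hr.le, ← mul_assoc,
      ← ENNReal.ofReal_mul (by positivity)]
    congr 2
    simp
    rw [div_pow]; ring
  rw [ENNReal.ofReal_mul (by positivity), mul_assoc, ← hm2]
  calc ENNReal.ofReal K⁻¹ * volume (ball x₁ (r / 8))
      ≤ ENNReal.ofReal K⁻¹ * (ENNReal.ofReal K * volume S) := by gcongr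
    _ = volume S := by
      rw [← mul_assoc, ← ENNReal.ofReal_mul (by positivity), inv_mul_cancel₀ hKp.ne']; simp
    _ ≤ _ := measure_mono fun x hx => hx.1

lemma barrier_deriv (b a : ℝ) (ha : 0 < a) (p : ℕ) (t : ℝ) (ht : 0 ≤ t) :
    HasDerivAt (fun t : ℝ => b * ((t + a) ^ p)⁻¹) (-(b * p * ((t + a) ^ (p + 1))⁻¹)) t := by
  have h0 : t + a ≠ 0 := by positivity
  have h1 : HasDerivAt (fun t : ℝ => t + a) 1 t := (hasDerivAt_id t).add_const a
  have h2 := ((h1.fun_pow p).fun_inv (pow_ne_zero _ h0)).const_mul b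
  refine h2.congr_deriv ?_
  rcases p with _ | p
  · simp
  · simp only [Nat.add_sub_cancel]
    field_simp
    ring

lemma barrier_lower {n : ℕ} (hn : 2 ≤ n) {lam Lam : ℝ} (hlam : 0 < lam) (hLam : lam ≤ Lam) :
    ∃ p : ℕ, 1 ≤ p ∧ ∀ (x₀ : En n) (s ρ L : ℝ) (u : En n → ℝ), 0 < s → s ≤ ρ → 0 ≤ L →
      Sol lam Lam x₀ (5 * ρ) u → (∀ x ∈ ball x₀ (5 * ρ), 0 ≤ u x) →
      (∀ x ∈ ball x₀ s, L ≤ u x) → ∀ y ∈ ball x₀ ρ,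
        L * ((s / ρ) ^ (2 * p) * (1 / 4) ^ p) ≤ u y := by
  have hLp : 0 < Lam := hlam.trans_le hLam
  obtain ⟨p, hp⟩ := exists_nat_gt (n * Lam / lam)
  have hp' : n * Lam < p * lam := by rwa [div_lt_iff₀ hlam] at hp
  have hp1 : 1 ≤ p := by
    rcases p with _ | p
    · exfalso
      have : 0 ≤ n * Lam := by positivity
      simp at hp'; linarith
    · omega
  refine ⟨p, hp1, ?_⟩
  intro x₀ s ρ L u hs hsρ hL hu hpos hLu y hy
  have hρ : 0 < ρ := hs.trans_le hsρ
  rcases hL.eq_or_lt with rfl | hL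
  · rw [zero_mul]
    exact hpos y (ball_subset_ball (by linarith) hy)
  set R : ℝ := 4 * ρ with hR
  set b : ℝ := L * s ^ (2 * p) with hb
  have hbp : 0 < b := by positivity
  have hs2 : 0 < s ^ 2 := by positivity
  set f : ℝ → ℝ := fun t => (-b) * ((t + s ^ 2) ^ p)⁻¹ with hf
  set f1 : ℝ → ℝ := fun t => (b * p) * ((t + s ^ 2) ^ (p + 1))⁻¹ with hf1
  have hfd : ∀ t, 0 ≤ t → HasDerivAt f (f1 t) t := fun t ht => by
    refine (barrier_deriv (-b) (s ^ 2) hs2 p t ht).congr_deriv ?_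
    simp [hf1]
  have hf1d : ∀ t, 0 ≤ t →
      HasDerivAt f1 (-(b * p * (p + 1) * ((t + s ^ 2) ^ (p + 2))⁻¹)) t := fun t ht => by
    refine (barrier_deriv (b * p) (s ^ 2) hs2 (p + 1) t ht).congr_deriv ?_
    push_cast; ring
  have hfc : ContDiff ℝ 2 (fun z : En n => f (‖z - x₀‖ ^ 2)) := by
    have h1 : ContDiff ℝ 2 (fun z : En n => ‖z - x₀‖ ^ 2 + s ^ 2) :=
      ((contDiff_id.sub contDiff_const).norm_sq ℝ).add contDiff_const
    refine contDiff_const.mul ((h1.pow p).inv fun z => ?_)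
    positivity
  have hsub : closedBall x₀ R ⊆ ball x₀ (5 * ρ) := closedBall_subset_ball (by linarith)
  have key : ∀ z ∈ closedBall x₀ R, f (R ^ 2) ≤ u z + f (‖z - x₀‖ ^ 2) := by
    obtain ⟨x, hxm, hxmin⟩ := (isCompact_closedBall x₀ R).exists_isMinOn
      ⟨x₀, mem_closedBall_self (by positivity)⟩
      ((hu.1.continuousOn.mono hsub).add hfc.continuous.continuousOn)
    suffices h : f (R ^ 2) ≤ u x + f (‖x - x₀‖ ^ 2) from
      fun z hz => h.trans (hxmin hz)
    have hxB := hsub hxm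
    have hux := hpos x hxB
    have hxR : ‖x - x₀‖ ≤ R := by rw [← dist_eq_norm]; exact hxm
    have hfneg : f (R ^ 2) ≤ 0 := by
      have : 0 ≤ b * ((R ^ 2 + s ^ 2) ^ p)⁻¹ := by positivity
      simp only [hf]; linarith
    rcases lt_or_ge (‖x - x₀‖) s with h1 | h1
    · have h2 := hLu x (by rw [mem_ball, dist_eq_norm]; exact h1)
      have h3 : b * ((‖x - x₀‖ ^ 2 + s ^ 2) ^ p)⁻¹ ≤ L := by
        rw [← div_eq_mul_inv, div_le_iff₀ (by positivity), hb, pow_mul]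
        gcongr
        have : 0 ≤ ‖x - x₀‖ ^ 2 := by positivity
        linarith
      have h4 : f (‖x - x₀‖ ^ 2) = - (b * ((‖x - x₀‖ ^ 2 + s ^ 2) ^ p)⁻¹) := by
        simp only [hf]; ring
      rw [h4]; linarith
    rcases hxR.eq_or_lt with h2 | h2
    · rw [h2]; linarith
    exfalso
    have hloc : IsLocalMin (fun z => u z + f (‖z - x₀‖ ^ 2)) x := by
      have h3 : IsMinOn (fun z => u z + f (‖z - x₀‖ ^ 2)) (closedBall x₀ R) x := hxmin
      refine h3.isLocalMin (mem_of_superset (isOpen_ball.mem_nhds ?_) ball_subset_closedBall)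
      rw [mem_ball, dist_eq_norm]; exact h2
    have huc : ContDiffAt ℝ 2 u x := hu.1.contDiffAt (isOpen_ball.mem_nhds hxB)
    have hqd : ContDiffAt ℝ 2 (fun z : En n => f (‖z - x₀‖ ^ 2)) x := hfc.contDiffAt
    set d : En n := x - x₀ with hd
    set G : ℝ := ‖d‖ ^ 2 + s ^ 2 with hG
    have hGp : 0 < G := by positivity
    set H : Fin n → Fin n → ℝ := fun i j => pd2 (fun z => u z + f (‖z - x₀‖ ^ 2)) i j x with hH
    have hHe : ∀ i j, H i j = pd2 u i j x + (-(4 * (b * p * (p + 1) * (G ^ (p + 2))⁻¹)) * (d i * d j)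
        + 2 * (b * p * (G ^ (p + 1))⁻¹) * (if i = j then 1 else 0)) := by
      intro i j
      rw [hH]
      simp only
      rw [pd2_add huc hqd, pd2_radial x₀ x hfd (hf1d _ (by positivity))]
      simp only [hf1, hG]
      ring
    have hHs : ∀ i j, H i j = H j i := fun i j => pd2_symm (huc.add hqd) i j
    have hHp : ∀ ξ : En n, 0 ≤ ∑ i, ∑ j, H i j * ξ i * ξ j := hess_min (huc.add hqd) hloc
    obtain ⟨A, hA, hA0⟩ := hu.2 x hxB
    have htr := (ell_trace hA H hHs hHp).1
    have htr0 : 0 ≤ ∑ i, H i i :=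
      (abs_nonneg _).trans (psd_entry_le H hHs hHp ⟨0, by omega⟩ ⟨0, by omega⟩)
    have hAtr : ∑ i, A i i ≤ n * Lam := by
      have : ∀ i, A i i ≤ Lam := fun i => by
        have := (hA (EuclideanSpace.single i 1)).2
        simpa [Pi.single_apply] using this
      calc ∑ i, A i i ≤ ∑ _i : Fin n, Lam := Finset.sum_le_sum fun i _ => this i
        _ = n * Lam := by simp
    have hAd : lam * ‖d‖ ^ 2 ≤ ∑ i, ∑ j, A i j * (d i * d j) := by
      have h3 := (hA d).1
      rw [EuclideanSpace.real_norm_sq_eq]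
      simpa [mul_assoc] using h3
    have hAH : ∑ i, ∑ j, A i j * H i j =
        -(4 * (b * p * (p + 1) * (G ^ (p + 2))⁻¹)) * (∑ i, ∑ j, A i j * (d i * d j)) +
        2 * (b * p * (G ^ (p + 1))⁻¹) * ∑ i, A i i := by
      simp_rw [hHe, mul_add, Finset.sum_add_distrib, hA0, zero_add]
      congr 1
      · simp_rw [Finset.mul_sum]
        exact Finset.sum_congr rfl fun i _ => Finset.sum_congr rfl fun j _ => by ring
      · rw [Finset.mul_sum]
        simp [mul_comm]
    have h5 : 0 ≤ ∑ i, ∑ j, A i j * H i j := (mul_nonneg hlam.le htr0).trans htr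
    have e1 : (G ^ (p + 1))⁻¹ = (G ^ (p + 2))⁻¹ * G := by
      field_simp
      ring
    rw [hAH, e1] at h5
    have hppos : (0 : ℝ) < p := by exact_mod_cast hp1
    set q : ℝ := b * p * (G ^ (p + 2))⁻¹ with hq
    have hqp : 0 < q := by positivity
    have h6 : 0 ≤ q * (-(4 * (p + 1)) * (∑ i, ∑ j, A i j * (d i * d j)) + 2 * G * ∑ i, A i i) := by
      refine h5.trans_eq ?_
      rw [hq]; ring
    have h7 := nonneg_of_mul_nonneg_right h6 hqp
    have hd2 : s ^ 2 ≤ ‖d‖ ^ 2 := by gcongr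
    have h8 : 2 * G * ∑ i, A i i ≤ 4 * ‖d‖ ^ 2 * (n * Lam) := by
      calc 2 * G * ∑ i, A i i ≤ 2 * G * (n * Lam) := by gcongr
        _ ≤ 4 * ‖d‖ ^ 2 * (n * Lam) := by
          have : 2 * G ≤ 4 * ‖d‖ ^ 2 := by rw [hG]; linarith
          gcongr
    have h9 : (4 * ((p : ℝ) + 1)) * (lam * ‖d‖ ^ 2) ≤
        (4 * (p + 1)) * (∑ i, ∑ j, A i j * (d i * d j)) := by gcongr
    have hdp : 0 < ‖d‖ ^ 2 := hs2.trans_le hd2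
    nlinarith [mul_pos hdp (sub_pos.2 hp'), mul_pos hdp hlam]
  have hyR : y ∈ closedBall x₀ R := by
    have : dist y x₀ < ρ := hy
    show dist y x₀ ≤ R
    linarith
  have h1 := key y hyR
  have hyd : ‖y - x₀‖ ≤ ρ := by rw [← dist_eq_norm]; exact le_of_lt hy
  set G : ℝ := ‖y - x₀‖ ^ 2 + s ^ 2 with hG
  have hGp : 0 < G := by positivity
  have hG2 : G ≤ 2 * ρ ^ 2 := by
    have h2 : ‖y - x₀‖ ^ 2 ≤ ρ ^ 2 := by gcongr
    have h3 : s ^ 2 ≤ ρ ^ 2 := by gcongr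
    linarith
  have h2 : b * ((G ^ p)⁻¹ - ((R ^ 2 + s ^ 2) ^ p)⁻¹) ≤ u y := by
    simp only [hf] at h1
    have : b * ((G ^ p)⁻¹ - ((R ^ 2 + s ^ 2) ^ p)⁻¹) =
      -b * ((R ^ 2 + s ^ 2) ^ p)⁻¹ - -b * (G ^ p)⁻¹ := by ring
    rw [this]; linarith
  refine le_trans ?_ h2
  have h3 : ((2 * ρ ^ 2) ^ p)⁻¹ ≤ (G ^ p)⁻¹ := by gcongr
  have h4 : ((R ^ 2 + s ^ 2) ^ p)⁻¹ ≤ ((4 * ρ ^ 2) ^ p)⁻¹ := by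
    gcongr
    rw [hR]; nlinarith [sq_nonneg ρ]
  have h5 : 2 * ((4 * ρ ^ 2) ^ p)⁻¹ ≤ ((2 * ρ ^ 2) ^ p)⁻¹ := by
    have e : (4 * ρ ^ 2) ^ p = 2 ^ p * (2 * ρ ^ 2) ^ p := by rw [← mul_pow]; ring
    have h6 : (2 : ℝ) ≤ 2 ^ p := by
      calc (2 : ℝ) = 2 ^ 1 := by norm_num
        _ ≤ 2 ^ p := by gcongr; norm_num
    rw [e, mul_inv, ← mul_assoc]
    have h7 : (2 : ℝ) * (2 ^ p)⁻¹ ≤ 1 := by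
      rw [← div_eq_mul_inv, div_le_one (by positivity)]; exact h6
    have h8 : 0 ≤ ((2 * ρ ^ 2) ^ p)⁻¹ := by positivity
    nlinarith
  have h6 : L * ((s / ρ) ^ (2 * p) * (1 / 4) ^ p) = b * ((4 * ρ ^ 2) ^ p)⁻¹ := by
    rw [hb, div_pow, mul_pow, pow_mul ρ 2 p, div_pow, one_pow]
    field_simp
  rw [h6]
  gcongr
  linarith

lemma vol_enlarge {n : ℕ} (hn : 2 ≤ n) (x : En n) {R : ℝ} (hR : 0 < R) :
    volume (closedBall x (5 * R)) = ENNReal.ofReal (5 ^ n) * volume (ball x R) := by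
  have : Nontrivial (En n) := by
    have : Nonempty (Fin n) := ⟨⟨0, by omega⟩⟩
    infer_instance
  rw [Measure.addHaar_closedBall_eq_addHaar_ball, Measure.addHaar_ball _ _ (by positivity),
    Measure.addHaar_ball _ _ hR.le, ← mul_assoc, ← ENNReal.ofReal_mul (by positivity), mul_pow]
  simp

lemma ink_spots {n : ℕ} (hn : 2 ≤ n) {x₀ : En n} {r θ : ℝ} {E F : Set (En n)} (hr : 0 < r)
    (hθ : 0 < θ) (hE : MeasurableSet E) (hEB : E ⊆ ball x₀ r)
    (hbad : ENNReal.ofReal θ * volume (ball x₀ r) ≤ volume (ball x₀ r \ E))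
    (hF : ∀ (p : En n) (ρ : ℝ), 0 < ρ → ρ ≤ r → ball p ρ ⊆ ball x₀ r →
      volume (ball p ρ \ E) < ENNReal.ofReal θ * volume (ball p ρ) →
      ball p (3 * ρ) ∩ ball x₀ r ⊆ F) :
    ENNReal.ofReal (θ / 5 ^ n) * volume E ≤ volume (F \ E) := by
  have : Nontrivial (En n) := by
    have : Nonempty (Fin n) := ⟨⟨0, by omega⟩⟩
    infer_instance
  set c : En n → ℕ → En n := fun x k => x₀ + (1 - (1 / 2 : ℝ) ^ k) • (x - x₀) with hc
  set rad : ℕ → ℝ := fun k => (1 / 2 : ℝ) ^ k * r with hrad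
  have hradp : ∀ k, 0 < rad k := fun k => by positivity
  have hrad1 : ∀ k, rad k ≤ r := fun k => by
    have : (1 / 2 : ℝ) ^ k ≤ 1 := pow_le_one₀ (by norm_num) (by norm_num)
    simp only [hrad]; nlinarith
  have hsub : ∀ x ∈ ball x₀ r, ∀ k, ball (c x k) (rad k) ⊆ ball x₀ r := by
    intro x hx k
    have hx' : ‖x - x₀‖ ≤ r := by rw [← dist_eq_norm]; exact le_of_lt hx
    have h1 : (1 / 2 : ℝ) ^ k ≤ 1 := pow_le_one₀ (by norm_num) (by norm_num)
    refine ball_subset_ball' ?_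
    have e : dist (c x k) x₀ = (1 - (1 / 2 : ℝ) ^ k) * ‖x - x₀‖ := by
      rw [dist_eq_norm]
      simp only [hc, add_sub_cancel_left, norm_smul, Real.norm_eq_abs]
      rw [abs_of_nonneg (by linarith)]
    rw [e]
    simp only [hrad]
    nlinarith
  have hmem : ∀ x ∈ ball x₀ r, ∀ k, x ∈ ball (c x k) (rad k) := by
    intro x hx k
    have hx' : ‖x - x₀‖ < r := by rw [← dist_eq_norm]; exact hx
    have e : x - c x k = (1 / 2 : ℝ) ^ k • (x - x₀) := by
      simp only [hc]
      module
    rw [mem_ball, dist_eq_norm, e, norm_smul, Real.norm_eq_abs, abs_of_pos (by positivity)]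
    simp only [hrad]
    gcongr
  have hsub3 : ∀ x ∈ ball x₀ r, ∀ k, ball (c x k) (rad k) ⊆ ball (c x (k + 1)) (3 * rad (k + 1)) := by
    intro x hx k
    have hx' : ‖x - x₀‖ ≤ r := by rw [← dist_eq_norm]; exact le_of_lt hx
    have e : c x k - c x (k + 1) = -((1 / 2 : ℝ) ^ (k + 1)) • (x - x₀) := by
      simp only [hc, pow_succ]
      module
    refine ball_subset_ball' ?_
    rw [dist_eq_norm, e, norm_smul, norm_neg, Real.norm_eq_abs, abs_of_pos (by positivity)]
    simp only [hrad, pow_succ]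
    have h1 : (0 : ℝ) < (1 / 2) ^ k := by positivity
    nlinarith
  set good : En n → ℕ → Prop := fun x k =>
    volume (ball (c x k) (rad k) \ E) < ENNReal.ofReal θ * volume (ball (c x k) (rad k)) with hgood
  have hae : ∀ᵐ x ∂(volume.restrict E), ∃ k, good x k := by
    filter_upwards [IsUnifLocDoublingMeasure.ae_tendsto_measure_inter_div (volume : Measure (En n)) E 1,
      ae_restrict_mem hE] with x hx hxE
    have hxB := hEB hxE
    have hlim : Tendsto rad atTop (𝓝[>] 0) := by
      rw [tendsto_nhdsWithin_iff]
      refine ⟨?_, Eventually.of_forall hradp⟩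
      have := (tendsto_pow_atTop_nhds_zero_of_lt_one (r := (1 / 2 : ℝ)) (by norm_num)
        (by norm_num)).mul_const r
      simpa [hrad] using this
    have h1 := hx (fun k => c x k) rad hlim (Eventually.of_forall fun k => by
      rw [one_mul]; exact ball_subset_closedBall (hmem x hxB k))
    have h2 : ∀ᶠ k in atTop, 1 - ENNReal.ofReal θ <
        volume (E ∩ closedBall (c x k) (rad k)) / volume (closedBall (c x k) (rad k)) := by
      refine h1.eventually_const_lt ?_
      exact ENNReal.sub_lt_self ENNReal.one_ne_top one_ne_zero (by simpa using hθ)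
    obtain ⟨k, hk⟩ := h2.exists
    refine ⟨k, ?_⟩
    simp only [hgood]
    have hv0 : volume (closedBall (c x k) (rad k)) ≠ 0 :=
      (measure_closedBall_pos volume _ (hradp k)).ne'
    have hvt : volume (closedBall (c x k) (rad k)) ≠ ⊤ := measure_closedBall_lt_top.ne
    have e1 : volume (ball (c x k) (rad k)) = volume (closedBall (c x k) (rad k)) :=
      (Measure.addHaar_closedBall_eq_addHaar_ball volume _ _).symm
    rw [e1]
    refine lt_of_le_of_lt (measure_mono (sdiff_subset_sdiff_left ball_subset_closedBall)) ?_
    set V := volume (closedBall (c x k) (rad k)) with hV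
    have h3 : volume (closedBall (c x k) (rad k) \ E) + volume (E ∩ closedBall (c x k) (rad k)) = V := by
      rw [inter_comm, add_comm]
      exact measure_inter_add_sdiff _ hE
    have h4 : (1 - ENNReal.ofReal θ) * V < volume (E ∩ closedBall (c x k) (rad k)) := by
      rwa [ENNReal.lt_div_iff_mul_lt (Or.inl hv0) (Or.inl hvt)] at hk
    by_contra hcon
    push Not at hcon
    have h5 : V ≤ ENNReal.ofReal θ * V + (1 - ENNReal.ofReal θ) * V := by
      rw [← add_mul]
      calc V = 1 * V := (one_mul V).symm
        _ ≤ _ := by gcongr; exact le_add_tsub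
    have h6 : ENNReal.ofReal θ * V + (1 - ENNReal.ofReal θ) * V < V := by
      rw [← h3] at hvt ⊢
      rw [← h3] at hcon h4
      refine ENNReal.add_lt_add_of_le_of_lt ?_ hcon h4
      exact ne_top_of_le_ne_top hvt (hcon.trans le_self_add)
    exact absurd h5 (not_le.2 h6)
  set t : Set (En n) := {x | x ∈ E ∧ ∃ k, good x k} with ht
  have hstep : ∀ x ∈ t, ∃ k, ¬ good x k ∧ good x (k + 1) := by
    rintro x ⟨hxE, hk⟩
    by_contra hcon
    push Not at hcon
    have h0 : ¬ good x 0 := by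
      simp only [hgood, hc, hrad]
      simpa using hbad
    have hall : ∀ k, ¬ good x k := fun k => by
      induction k with
      | zero => exact h0
      | succ k ih => exact hcon k ih
    obtain ⟨k, hk⟩ := hk
    exact hall k hk
  choose! κ hκ1 hκ2 using hstep
  obtain ⟨v, hvt, hvd, hvc⟩ := Vitali.exists_disjoint_subfamily_covering_enlargement_closedBall t
    (fun x => c x (κ x)) (fun x => rad (κ x)) r (fun x _ => hrad1 _) 5 (by norm_num)
  set D : En n → Set (En n) := fun x => ball (c x (κ x)) (rad (κ x)) with hD
  have hDd : v.PairwiseDisjoint D := hvd.mono fun x => ball_subset_closedBall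
  have hvcount : v.Countable := hDd.countable_of_isOpen (fun _ _ => isOpen_ball)
    (fun x _ => nonempty_ball.2 (hradp _))
  have hDF : ∀ x ∈ v, D x ⊆ F := by
    intro x hx z hz
    have hxt := hvt hx
    have hxB := hEB hxt.1
    exact hF _ _ (hradp _) (hrad1 _) (hsub x hxB _) (hκ2 x hxt) ⟨hsub3 x hxB _ hz, hsub x hxB _ hz⟩
  have hET : volume E ≤ volume (⋃ b ∈ v, closedBall (c b (κ b)) (5 * rad (κ b))) := by
    refine measure_mono_ae ?_
    rw [ae_restrict_iff' hE] at hae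
    filter_upwards [hae] with x hx hxE
    have hxt : x ∈ t := ⟨hxE, hx hxE⟩
    obtain ⟨b, hb, hb'⟩ := hvc x hxt
    exact mem_biUnion hb (hb' (ball_subset_closedBall (hmem x (hEB hxE) _)))
  have h5 : ∀ b : En n, volume (closedBall (c b (κ b)) (5 * rad (κ b))) =
      ENNReal.ofReal (5 ^ n) * volume (D b) := by
    intro b
    exact vol_enlarge hn _ (hradp _)
  have h6 : ∀ b ∈ v, ENNReal.ofReal θ * volume (D b) ≤ volume (D b \ E) := by
    intro b hb
    have := hκ1 b (hvt hb)
    simpa [hgood] using this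
  have hcal : ENNReal.ofReal (θ / 5 ^ n) * volume E ≤ ∑' b : v, volume (D b \ E) := by
    calc ENNReal.ofReal (θ / 5 ^ n) * volume E
        ≤ ENNReal.ofReal (θ / 5 ^ n) * ∑' b : v, (ENNReal.ofReal (5 ^ n) * volume (D b)) := by
          gcongr
          refine hET.trans ((measure_biUnion_le _ hvcount _).trans_eq ?_)
          exact tsum_congr fun b => h5 b
      _ = ∑' b : v, ENNReal.ofReal θ * volume (D b) := by
          rw [← ENNReal.tsum_mul_left]
          refine tsum_congr fun b => ?_
          rw [← mul_assoc, ← ENNReal.ofReal_mul (by positivity)]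
          congr 2
          field_simp
      _ ≤ _ := ENNReal.tsum_le_tsum fun b => h6 b b.2
  refine hcal.trans ?_
  rw [← measure_biUnion hvcount (hDd.mono fun x => sdiff_subset)
    (fun x _ => measurableSet_ball.diff hE)]
  exact measure_mono (iUnion₂_subset fun b hb => sdiff_subset_sdiff_left (hDF b hb))

lemma growth_small {n : ℕ} (hn : 2 ≤ n) {lam Lam : ℝ} (hlam : 0 < lam) (hLam : lam ≤ Lam) :
    ∃ θ c : ℝ, 0 < θ ∧ 0 < c ∧ c ≤ 1 ∧ ∀ (p : En n) (ρ : ℝ) (u : En n → ℝ), 0 < ρ →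
      Sol lam Lam p (15 * ρ) u → (∀ x ∈ ball p (15 * ρ), 0 ≤ u x) →
      volume {x | x ∈ ball p ρ ∧ u x < 1} < ENNReal.ofReal θ * volume (ball p ρ) →
      ∀ x ∈ ball p (3 * ρ), c ≤ u x := by
  obtain ⟨θ, hθ, hcm⟩ := contact_measure hn hlam hLam
  obtain ⟨q, hq, hbar⟩ := barrier_lower hn hlam hLam
  refine ⟨θ, 8 / 9 * ((1 / 6) ^ (2 * q) * (1 / 4) ^ q), hθ, by positivity, ?_, ?_⟩
  · have h1 : (1 / 6 : ℝ) ^ (2 * q) ≤ 1 := pow_le_one₀ (by norm_num) (by norm_num)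
    have h2 : (1 / 4 : ℝ) ^ q ≤ 1 := pow_le_one₀ (by norm_num) (by norm_num)
    have h3 : (1 / 6 : ℝ) ^ (2 * q) * (1 / 4) ^ q ≤ 1 := mul_le_one₀ h1 (by positivity) h2
    linarith
  intro p ρ u hρ hu hpos hvol x hx
  have hs : ball p ρ ⊆ ball p (15 * ρ) := ball_subset_ball (by linarith)
  have h1 : ∀ z ∈ ball p (ρ / 2), 8 / 9 ≤ u z := by
    intro z hz
    by_contra hcon
    push Not at hcon
    exact absurd (hcm p ρ u hρ (hu.mono hs) (fun x hx => hpos x (hs hx)) z hz hcon) (not_le.2 hvol)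
  have e5 : 5 * (3 * ρ) = 15 * ρ := by ring
  have h2 := hbar p (ρ / 2) (3 * ρ) (8 / 9) u (by positivity) (by linarith) (by norm_num)
    (by rw [e5]; exact hu) (by rw [e5]; exact hpos) h1 x hx
  have e6 : ρ / 2 / (3 * ρ) = 1 / 6 := by field_simp; norm_num
  rwa [e6] at h2

lemma growth {n : ℕ} (hn : 2 ≤ n) {lam Lam : ℝ} (hlam : 0 < lam) (hLam : lam ≤ Lam)
    (μ : ℝ) (hμ : 0 < μ) :
    ∃ c : ℝ, 0 < c ∧ ∀ (x₀ : En n) (r : ℝ) (u : En n → ℝ), 0 < r →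
      Sol lam Lam x₀ (20 * r) u → (∀ x ∈ ball x₀ (20 * r), 0 ≤ u x) →
      ENNReal.ofReal μ * volume (ball x₀ r) ≤ volume {x | x ∈ ball x₀ r ∧ 1 ≤ u x} →
      ∀ x ∈ ball x₀ r, c ≤ u x := by
  obtain ⟨θ, c, hθ, hc, hc1, hgs⟩ := growth_small hn hlam hLam
  set δ : ℝ := θ / 5 ^ n with hδ
  have hδp : 0 < δ := by positivity
  have main : ∀ (j : ℕ) (x₀ : En n) (r : ℝ) (u : En n → ℝ), 0 < r →
      Sol lam Lam x₀ (20 * r) u → (∀ x ∈ ball x₀ (20 * r), 0 ≤ u x) →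
      volume (ball x₀ r) ≤ ENNReal.ofReal ((1 + δ) ^ j) * volume {x | x ∈ ball x₀ r ∧ 1 ≤ u x} →
      ∀ x ∈ ball x₀ r, c ^ (j + 1) ≤ u x := by
    intro j
    induction j with
    | zero =>
      intro x₀ r u hr hu hpos hvol x hx
      have hs : ball x₀ (15 * r) ⊆ ball x₀ (20 * r) := ball_subset_ball (by linarith)
      have hs1 : ball x₀ r ⊆ ball x₀ (20 * r) := ball_subset_ball (by linarith)
      rw [zero_add, pow_one]
      refine hgs x₀ r u hr (hu.mono hs) (fun x hx => hpos x (hs hx)) ?_ x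
        (ball_subset_ball (by linarith) hx)
      have hm : MeasurableSet {x | x ∈ ball x₀ r ∧ u x < 1} :=
        ((hu.1.continuousOn.mono hs1).isOpen_inter_preimage isOpen_ball isOpen_Iio).measurableSet
      have hb0 := measure_ball_pos volume x₀ hr
      have hbt : volume (ball x₀ r) ≠ ⊤ := measure_ball_lt_top.ne
      have e : {x | x ∈ ball x₀ r ∧ 1 ≤ u x} = ball x₀ r \ {x | x ∈ ball x₀ r ∧ u x < 1} := by
        ext z; simp; tauto
      have hadd := measure_inter_add_sdiff (μ := volume) (ball x₀ r) hm
      rw [← e, inter_eq_right.2 (fun z hz => hz.1)] at hadd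
      have hz : volume {x | x ∈ ball x₀ r ∧ u x < 1} = 0 := by
        simp only [pow_zero, ENNReal.ofReal_one, one_mul] at hvol
        have h1 : volume {x | x ∈ ball x₀ r ∧ 1 ≤ u x} ≠ ⊤ :=
          ne_top_of_le_ne_top hbt (measure_mono fun z hz => hz.1)
        rw [← hadd] at hvol
        have h2 : volume {x | x ∈ ball x₀ r ∧ u x < 1} + volume {x | x ∈ ball x₀ r ∧ 1 ≤ u x} ≤
          0 + volume {x | x ∈ ball x₀ r ∧ 1 ≤ u x} := by simpa using hvol
        exact le_antisymm ((ENNReal.add_le_add_iff_right h1).1 h2) (zero_le)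
      rw [hz]
      exact ENNReal.mul_pos (by simpa using hθ) hb0.ne'
    | succ j ih =>
      intro x₀ r u hr hu hpos hvol x hx
      have hs : ball x₀ (15 * r) ⊆ ball x₀ (20 * r) := ball_subset_ball (by linarith)
      have hs1 : ball x₀ r ⊆ ball x₀ (20 * r) := ball_subset_ball (by linarith)
      set E : Set (En n) := {x | x ∈ ball x₀ r ∧ 1 ≤ u x} with hE
      set F : Set (En n) := {x | x ∈ ball x₀ r ∧ c ≤ u x} with hF
      have hEe : E = ball x₀ r \ {x | x ∈ ball x₀ r ∧ u x < 1} := by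
        ext z; simp [hE]; tauto
      have hEm : MeasurableSet E := by
        rw [hEe]
        exact measurableSet_ball.diff
          ((hu.1.continuousOn.mono hs1).isOpen_inter_preimage isOpen_ball isOpen_Iio).measurableSet
      by_cases hgood : volume (ball x₀ r \ E) < ENNReal.ofReal θ * volume (ball x₀ r)
      · have h1 : c ≤ u x := by
          refine hgs x₀ r u hr (hu.mono hs) (fun x hx => hpos x (hs hx)) ?_ x
            (ball_subset_ball (by linarith) hx)
          refine lt_of_le_of_lt (measure_mono ?_) hgood
          rintro z ⟨hz1, hz2⟩
          exact ⟨hz1, fun h => absurd h.2 (not_le.2 hz2)⟩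
        refine le_trans ?_ h1
        exact pow_le_of_le_one hc.le hc1 (by omega)
      · push Not at hgood
        have hink := ink_spots (F := F) hn hr hθ hEm (fun z hz => hz.1) hgood (by
          intro p ρ hρ hρr hsub hsm z hz
          have hp : dist p x₀ < r := hsub (mem_ball_self hρ)
          have hs2 : ball p (15 * ρ) ⊆ ball x₀ (20 * r) := ball_subset_ball' (by linarith)
          refine ⟨hz.2, hgs p ρ u hρ (hu.mono hs2) (fun x hx => hpos x (hs2 hx)) ?_ z hz.1⟩
          refine lt_of_le_of_lt (measure_mono ?_) hsm
          rintro z ⟨hz1, hz2⟩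
          exact ⟨hz1, fun h => absurd h.2 (not_le.2 hz2)⟩)
        have hEF : E ⊆ F := fun z hz => ⟨hz.1, hc1.trans hz.2⟩
        have hFv : ENNReal.ofReal (1 + δ) * volume E ≤ volume F := by
          have hadd := measure_inter_add_sdiff (μ := volume) F hEm
          rw [inter_eq_right.2 hEF] at hadd
          rw [← hadd, ENNReal.ofReal_add zero_le_one hδp.le, add_mul, ENNReal.ofReal_one, one_mul]
          gcongr
        have hFe : {x | x ∈ ball x₀ r ∧ 1 ≤ c⁻¹ * u x + 0} = F := by
          ext z
          simp only [hF, mem_setOf_eq, add_zero]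
          rw [← div_eq_inv_mul, one_le_div hc]
        have h3 := ih x₀ r (fun z => c⁻¹ * u z + 0) hr (hu.affine c⁻¹ 0)
          (fun z hz => by have := hpos z hz; positivity) (by
            rw [hFe]
            refine hvol.trans ?_
            rw [pow_succ, ENNReal.ofReal_mul (by positivity), mul_assoc]
            gcongr) x hx
        rw [add_zero, ← div_eq_inv_mul, le_div_iff₀ hc] at h3
        rw [pow_succ]
        exact h3
  obtain ⟨j, hj⟩ := pow_unbounded_of_one_lt μ⁻¹ (show 1 < 1 + δ by linarith)
  refine ⟨c ^ (j + 1), by positivity, ?_⟩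
  intro x₀ r u hr hu hpos hvol
  refine main j x₀ r u hr hu hpos ?_
  calc volume (ball x₀ r) = ENNReal.ofReal μ⁻¹ * (ENNReal.ofReal μ * volume (ball x₀ r)) := by
        rw [← mul_assoc, ← ENNReal.ofReal_mul (by positivity), inv_mul_cancel₀ hμ.ne']; simp
    _ ≤ _ := by gcongr

lemma local_harnack {n : ℕ} (hn : 2 ≤ n) {lam Lam : ℝ} (hlam : 0 < lam) (hLam : lam ≤ Lam) :
    ∃ C : ℝ, 0 < C ∧ ∀ (x y : En n) (r : ℝ) (u : En n → ℝ), 0 < r →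
      Sol lam Lam x (30 * r) u → (∀ z ∈ ball x (30 * r), 0 ≤ u z) → dist x y < r →
      u x ≤ C * u y := by
  obtain ⟨θ, hθ, hcm⟩ := contact_measure hn hlam hLam
  obtain ⟨p, hp, hbar⟩ := barrier_lower hn hlam hLam
  obtain ⟨c, hc, hgr⟩ := growth hn hlam hLam θ hθ
  set q : ℕ := 2 * p with hq
  have hq0 : (1 : ℝ) ≤ q := by
    have : 1 ≤ q := by omega
    exact_mod_cast this
  set τ : ℝ := 1 / (10 * q) with hτ
  have hτp : 0 < τ := by positivity
  have hτ1 : τ ≤ 1 / 10 := by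
    rw [hτ]
    exact one_div_le_one_div_of_le (by norm_num) (by linarith)
  have hτq : 1 ≤ 5 / 4 * (1 - τ) ^ q := by
    have h1 := one_add_mul_le_pow (a := -τ) (by linarith) q
    have h2 : (q : ℝ) * τ = 1 / 10 := by rw [hτ]; field_simp
    have h3 : (1 : ℝ) + q * (-τ) = 9 / 10 := by rw [mul_neg, h2]; norm_num
    rw [h3, ← sub_eq_add_neg] at h1
    linarith
  set κ : ℝ := c / 2 * ((τ / 2) ^ q * (1 / 4) ^ p) with hκ
  have hκp : 0 < κ := by positivity
  refine ⟨κ⁻¹, by positivity, ?_⟩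
  intro x y r u hr hu hpos hxy
  rw [← div_eq_inv_mul, le_div_iff₀ hκp, mul_comm]
  have hyB : y ∈ ball x (30 * r) := by
    rw [mem_ball, dist_comm]; linarith
  have huy := hpos y hyB
  have hcs : closedBall x r ⊆ ball x (30 * r) := closedBall_subset_ball (by linarith)
  have hdc : Continuous (fun z : En n => (r - dist z x) ^ q) := by fun_prop
  obtain ⟨p₀, hp₀, hmax⟩ := (isCompact_closedBall x r).exists_isMaxOn
    ⟨x, mem_closedBall_self hr.le⟩ ((hu.1.continuousOn.mono hcs).mul hdc.continuousOn)
  have hmax' : ∀ z ∈ closedBall x r, u z * (r - dist z x) ^ q ≤ u p₀ * (r - dist p₀ x) ^ q :=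
    fun z hz => hmax hz
  have hp₀d : dist p₀ x ≤ r := hp₀
  set d : ℝ := r - dist p₀ x with hd
  have hd0 : 0 ≤ d := by rw [hd]; linarith
  have hdr : d ≤ r := by rw [hd]; linarith [dist_nonneg (x := p₀) (y := x)]
  set M : ℝ := u p₀ with hM
  have hM0 : 0 ≤ M := hpos _ (hcs hp₀)
  have hx := hmax' x (mem_closedBall_self hr.le)
  rw [dist_self, sub_zero] at hx
  rcases (mul_nonneg hM0 (pow_nonneg hd0 q)).eq_or_lt with h0 | h0
  · rw [← h0] at hx
    have : u x ≤ 0 := by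
      by_contra hcon
      push Not at hcon
      have : 0 < u x * r ^ q := by positivity
      linarith
    nlinarith
  have hMp : 0 < M := by
    rcases hM0.eq_or_lt with h | h
    · rw [← h] at h0; simp at h0
    · exact h
  have hdp : 0 < d := by
    rcases hd0.eq_or_lt with h | h
    · rw [← h, zero_pow (by omega)] at h0; simp at h0
    · exact h
  set ρ : ℝ := τ * d with hρ
  have hρp : 0 < ρ := by positivity
  have hρr : ρ ≤ r / 10 := by
    calc ρ ≤ 1 / 10 * r := by rw [hρ]; gcongr
      _ = r / 10 := by ring
  have hup : ∀ z ∈ ball p₀ ρ, u z ≤ 5 / 4 * M := by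
    intro z hz
    have hz' : dist z p₀ < ρ := hz
    have h1 := dist_triangle z p₀ x
    have h2 : (1 - τ) * d ≤ r - dist z x := by
      have : (1 - τ) * d = d - ρ := by rw [hρ]; ring
      rw [this, hd]; linarith
    have h3 : 0 ≤ (1 - τ) * d := mul_nonneg (by linarith) hd0
    have hzc : z ∈ closedBall x r := by
      show dist z x ≤ r
      linarith
    have huz := hpos z (hcs hzc)
    have h4 : u z * ((1 - τ) * d) ^ q ≤ M * d ^ q :=
      le_trans (by gcongr) (hmax' z hzc)
    rw [mul_pow, ← mul_assoc] at h4
    have h5 : u z * (1 - τ) ^ q ≤ M := le_of_mul_le_mul_right h4 (by positivity)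
    nlinarith
  have hs1 : ball p₀ ρ ⊆ ball x (30 * r) := ball_subset_ball' (by linarith)
  have hs2 : ball p₀ (20 * ρ) ⊆ ball x (30 * r) := ball_subset_ball' (by linarith)
  have hs3 : ball p₀ (5 * (2 * r)) ⊆ ball x (30 * r) := ball_subset_ball' (by linarith)
  have hw := hcm p₀ ρ (fun z => (-2 / M) * u z + 5 / 2) hρp ((hu.mono hs1).affine _ _) (by
    intro z hz
    have h1 := hup z hz
    have h2 : 2 / M * u z ≤ 5 / 2 := by
      rw [div_mul_eq_mul_div, div_le_iff₀ hMp]; linarith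
    have h3 : -2 / M * u z = - (2 / M * u z) := by ring
    rw [h3]; linarith) p₀ (mem_ball_self (by positivity)) (by
    have : -2 / M * u p₀ = -2 := by rw [← hM]; field_simp
    rw [this]; norm_num)
  have hL := hgr p₀ ρ (fun z => (2 / M) * u z + 0) hρp ((hu.mono hs2).affine _ _) (by
    intro z hz
    have := hpos z (hs2 hz)
    positivity) (by
    refine hw.trans (measure_mono ?_)
    rintro z ⟨hz1, hz2⟩
    refine ⟨hz1, ?_⟩
    have h3 : -2 / M * u z = - (2 / M * u z) := by ring
    rw [h3] at hz2
    linarith)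
  have hfin := hbar p₀ ρ (2 * r) (c * M / 2) u hρp (by linarith) (by positivity) (hu.mono hs3)
    (fun z hz => hpos z (hs3 hz)) (by
      intro z hz
      have := hL z hz
      rw [add_zero, div_mul_eq_mul_div, le_div_iff₀ hMp] at this
      linarith) y (by
      have h1 := dist_triangle y x p₀
      rw [dist_comm y x, dist_comm x p₀] at h1
      show dist y p₀ < 2 * r
      linarith)
  refine le_trans ?_ hfin
  have e : c * M / 2 * ((ρ / (2 * r)) ^ (2 * p) * (1 / 4) ^ p) = κ * (M * d ^ q / r ^ q) := by
    have e0 : ρ / (2 * r) = τ / 2 * (d / r) := by rw [hρ]; ring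
    rw [← hq, hκ, e0, mul_pow, div_pow d r]
    ring
  rw [e]
  gcongr
  rw [le_div_iff₀ (by positivity)]
  exact hx

lemma chain_harnack {n : ℕ} {C : ℝ} (hC : 0 < C) (v : En n → ℝ)
    (h : ∀ x ∈ ball (0 : En n) (1 / 2), ∀ y ∈ ball (0 : En n) (1 / 2), dist x y < 1 / 60 →
      v x ≤ C * v y) (N : ℕ) :
    ∀ x ∈ ball (0 : En n) (1 / 2), ∀ y ∈ ball (0 : En n) (1 / 2), dist x y ≤ N / 61 →
      v x ≤ C ^ N * v y := by
  induction N with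
  | zero =>
    intro x _ y _ hxy
    have : x = y := dist_le_zero.1 (by simpa using hxy)
    simp [this]
  | succ N ih =>
    intro x hx y hy hxy
    set t : ℝ := 1 / (N + 1) with ht
    have hN : (0 : ℝ) < N + 1 := by positivity
    have ht0 : 0 < t := by positivity
    have ht1 : t ≤ 1 := by
      rw [ht, div_le_one hN]; linarith [Nat.cast_nonneg (α := ℝ) N]
    set z : En n := y + t • (x - y) with hz
    have hzB : z ∈ ball (0 : En n) (1 / 2) := by
      have := (convex_ball (0 : En n) (1 / 2)).add_smul_sub_mem hy hx ⟨ht0.le, ht1⟩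
      exact this
    push_cast at hxy
    have h1 : dist z y < 1 / 60 := by
      rw [dist_eq_norm, hz, add_sub_cancel_left, norm_smul, Real.norm_eq_abs, abs_of_pos ht0,
        ← dist_eq_norm]
      have : t * dist x y ≤ t * ((N + 1) / 61) := by gcongr
      have e : t * ((N + 1) / 61) = 1 / 61 := by rw [ht]; field_simp
      rw [e] at this
      exact this.trans_lt (by norm_num)
    have h2 : dist x z ≤ N / 61 := by
      have e : x - z = (1 - t) • (x - y) := by rw [hz]; module
      rw [dist_eq_norm, e, norm_smul, Real.norm_eq_abs, abs_of_nonneg (by linarith),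
        ← dist_eq_norm]
      have : (1 - t) * dist x y ≤ (1 - t) * ((N + 1) / 61) := by
        have : 0 ≤ 1 - t := by linarith
        gcongr
      have e : (1 - t) * ((N + 1) / 61) = N / 61 := by rw [ht]; field_simp; ring
      linarith
    calc v x ≤ C ^ N * v z := ih x hx z hzB h2
      _ ≤ C ^ N * (C * v y) := by
        have := h z hzB y hy h1
        gcongr
      _ = C ^ (N + 1) * v y := by ring
/-- **Krylov–Safonov Harnack inequality (1979).** There is `C > 0` depending only on `n, λ, Λ`
such that any nonnegative `C²` solution of `Σ a_{ij}(x) ∂_{ij} v = 0` in `B₁`, with merely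
measurable uniformly elliptic coefficients, satisfies `sup_{B_{1/2}} v ≤ C inf_{B_{1/2}} v`. -/
theorem krylov_safonov_harnack
    (n : ℕ) (hn : 2 ≤ n) (lam Lam : ℝ) (hlam : 0 < lam) (hLam : lam ≤ Lam) :
    ∃ C : ℝ, 0 < C ∧
      ∀ (a : Fin n → Fin n → En n → ℝ) (v : En n → ℝ),
        UnifEllipticOn (ball (0 : En n) 1) lam Lam a →
        ContDiffOn ℝ 2 v (ball (0 : En n) 1) →
        (∀ x ∈ ball (0 : En n) 1, 0 ≤ v x) →
        (∀ x ∈ ball (0 : En n) 1, ∑ i, ∑ j, a i j x * pd2 v i j x = 0) →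
        ∀ x ∈ ball (0 : En n) (1 / 2), ∀ y ∈ ball (0 : En n) (1 / 2), v x ≤ C * v y := by
  obtain ⟨C, hC, hloc⟩ := local_harnack hn hlam hLam
  refine ⟨C ^ 61, by positivity, ?_⟩
  intro a v ha hv hpos heq x hx y hy
  have hsol : Sol lam Lam (0 : En n) 1 v :=
    ⟨hv, fun z hz => ⟨fun i j => a i j z, ha.2 z hz, heq z hz⟩⟩
  refine chain_harnack hC v ?_ 61 x hx y hy ?_
  · intro z hz w _ hzw
    have hz' : dist z 0 < 1 / 2 := hz
    have hs : ball z (30 * (1 / 60)) ⊆ ball (0 : En n) 1 := ball_subset_ball' (by linarith)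
    exact hloc z w (1 / 60) v (by norm_num) (hsol.mono hs) (fun p hp => hpos p (hs hp)) hzw
  · have h1 : dist x 0 < 1 / 2 := hx
    have h2 : dist y 0 < 1 / 2 := hy
    have h3 := dist_triangle_right x y 0
    push_cast
    linarith
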